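/- arXiv:cs/0106001 — 2 statements merged into one kernel-verified Lean document; each statement's English description precedes it below -/
import Mathlib

section
/- P_{n,⌊0.88949·n⌋}(3-XOR-SAT) tends to 1 as n → ∞; in other words, the satisfiability threshold of random 3-XOR-formulas satisfies α_3 ≥ 0.88949. -/
open Finset Filter

attribute [local instance] Classical.propDecidable

/-- A `k`-XOR-clause over `n` variables: a `k`-element set of variables
together with a right-hand side in `GF(2) = ZMod 2`. -/
abbrev Clause (n k : ℕ) := {S : Finset (Fin n) // S.card = k} × ZMod 2

/-- A formula in `Ω(n,L,k)`: an ordered `L`-tuple of `k`-XOR-clauses. -/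
abbrev Formula (n L k : ℕ) := Fin L → Clause n k

/-- A formula is satisfiable iff some assignment satisfies every clause. -/
def Satisfiable {n L k : ℕ} (F : Formula n L k) : Prop :=
  ∃ I : Fin n → ZMod 2, ∀ i : Fin L, ∑ j ∈ (F i).1.1, I j = (F i).2

/-- The number of satisfiable formulas in `Ω(n,L,k)`. -/
noncomputable def numSat (n L k : ℕ) : ℕ :=
  Nat.card {F : Formula n L k // Satisfiable F}

/-- `P_{n,L}(k-XOR-SAT)`: the fraction of satisfiable formulas in `Ω(n,L,k)`,
whose total number is `(2 * C(n,k))^L`. -/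
noncomputable def Psat (n L k : ℕ) : ℝ :=
  (numSat n L k : ℝ) / (2 * (n.choose k : ℝ)) ^ L

noncomputable def satIndicator {n k : ℕ} (I : Fin n → ZMod 2) (c : Clause n k) : ℝ :=
  if ∑ j ∈ c.1.1, I j = c.2 then 1 else 0

noncomputable def evenCount (n k : ℕ) (D : Fin n → ZMod 2) : ℝ :=
  ∑ S : {S : Finset (Fin n) // S.card = k}, if ∑ j ∈ S.1, D j = 0 then 1 else 0

noncomputable def numModels {n L k : ℕ} (F : Formula n L k) : ℝ :=
  ∑ I : Fin n → ZMod 2, ∏ i, satIndicator I (F i)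

lemma sum_satIndicator {n k : ℕ} (I : Fin n → ZMod 2) :
    ∑ c : Clause n k, satIndicator I c = n.choose k := by
  rw [Fintype.sum_prod_type]
  simp [satIndicator]

lemma sum_satIndicator_mul {n k : ℕ} (I J : Fin n → ZMod 2) :
    ∑ c : Clause n k, satIndicator I c * satIndicator J c = evenCount n k (I - J) := by
  rw [Fintype.sum_prod_type]
  refine Finset.sum_congr rfl fun S _ => ?_
  simp [satIndicator, sub_eq_zero, eq_comm]

lemma sum_numModels (n L k : ℕ) :
    ∑ F : Formula n L k, numModels F = 2 ^ n * (n.choose k : ℝ) ^ L := by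
  simp only [numModels]
  rw [Finset.sum_comm]
  simp only [← Fintype.sum_pow, sum_satIndicator]
  simp

lemma sum_numModels_sq (n L k : ℕ) :
    ∑ F : Formula n L k, numModels F ^ 2 = 2 ^ n * ∑ D, evenCount n k D ^ L := by
  have h1 : ∀ F : Formula n L k, numModels F ^ 2 =
      ∑ I : Fin n → ZMod 2, ∑ J : Fin n → ZMod 2,
        ∏ i, (satIndicator I (F i) * satIndicator J (F i)) := by
    intro F
    simp only [numModels, sq, Finset.sum_mul_sum, Finset.prod_mul_distrib]
  have h2 : ∀ I J : Fin n → ZMod 2, ∑ F : Formula n L k,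
      ∏ i, (satIndicator I (F i) * satIndicator J (F i)) = evenCount n k (I - J) ^ L := by
    intro I J
    rw [← sum_satIndicator_mul, Fintype.sum_pow]
  have h3 : ∀ J : Fin n → ZMod 2, ∑ I, evenCount n k (I - J) ^ L = ∑ D, evenCount n k D ^ L :=
    fun J => Equiv.sum_comp (Equiv.subRight J) fun D => evenCount n k D ^ L
  calc ∑ F : Formula n L k, numModels F ^ 2
      = ∑ I : Fin n → ZMod 2, ∑ J : Fin n → ZMod 2, evenCount n k (I - J) ^ L := by
        simp only [h1]
        rw [Finset.sum_comm]
        refine Finset.sum_congr rfl fun I _ => ?_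
        rw [Finset.sum_comm]
        exact Finset.sum_congr rfl fun J _ => h2 I J
    _ = 2 ^ n * ∑ D, evenCount n k D ^ L := by
        rw [Finset.sum_comm]
        simp [h3]

lemma numModels_eq_zero {n L k : ℕ} {F : Formula n L k} (hF : ¬ Satisfiable F) :
    numModels F = 0 := by
  refine Finset.sum_eq_zero fun I _ => ?_
  by_contra h
  refine hF ⟨I, fun i => ?_⟩
  by_contra hi
  exact h (Finset.prod_eq_zero (Finset.mem_univ i) (by simp [satIndicator, hi]))

lemma second_moment (n L k : ℕ) :
    (2 ^ n * (n.choose k : ℝ) ^ L) ^ 2 ≤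
      numSat n L k * (2 ^ n * ∑ D, evenCount n k D ^ L) := by
  rw [← sum_numModels, ← sum_numModels_sq]
  have h := Finset.sum_mul_sq_le_sq_mul_sq univ
    (fun F : Formula n L k => if Satisfiable F then (1 : ℝ) else 0) numModels
  have e1 : ∀ F : Formula n L k, (if Satisfiable F then (1 : ℝ) else 0) * numModels F =
      numModels F := by
    intro F
    split_ifs with hF
    · simp
    · simp [numModels_eq_zero hF]
  have e2 : ∑ F : Formula n L k, (if Satisfiable F then (1 : ℝ) else 0) ^ 2 = numSat n L k := by
    simp [numSat, Nat.card_eq_fintype_card, Fintype.card_subtype, ite_pow]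
  simpa only [e1, e2] using h

lemma numSat_le (n L k : ℕ) : (numSat n L k : ℝ) ≤ (2 * (n.choose k : ℝ)) ^ L := by
  have h : numSat n L k ≤ Nat.card (Formula n L k) :=
    Nat.card_le_card_of_injective _ Subtype.val_injective
  have h2 : Nat.card (Formula n L k) = (2 * n.choose k) ^ L := by
    simp [mul_comm]
  rw [h2] at h
  exact_mod_cast h

lemma evenCount_nonneg {n k : ℕ} (D : Fin n → ZMod 2) : 0 ≤ evenCount n k D :=
  Finset.sum_nonneg fun _ _ => by split_ifs <;> norm_num

lemma inv_le_Psat {n L k : ℕ} (hk : k ≤ n) {B : ℝ} (hB : 0 < B)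
    (h : ∑ D, (2 * evenCount n k D / n.choose k) ^ L ≤ 2 ^ n * B) : B⁻¹ ≤ Psat n L k := by
  have hC : (0 : ℝ) < n.choose k := by exact_mod_cast Nat.choose_pos hk
  have hm := second_moment n L k
  have e : ∑ D, (2 * evenCount n k D / n.choose k) ^ L =
      (2 / (n.choose k : ℝ)) ^ L * ∑ D, evenCount n k D ^ L := by
    rw [Finset.mul_sum]
    refine Finset.sum_congr rfl fun D _ => ?_
    rw [← mul_pow]
    ring
  rw [e, div_pow, div_mul_eq_mul_div, div_le_iff₀ (by positivity)] at h
  have hpos : (0 : ℝ) < (n.choose k : ℝ) ^ L := by positivity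
  rw [Psat, le_div_iff₀ (by positivity), inv_mul_le_iff₀ hB, mul_pow]
  have h4 : (0 : ℝ) < 2 ^ n * 2 ^ n * (n.choose k : ℝ) ^ L := by positivity
  refine le_of_mul_le_mul_left ?_ h4
  have hns : (0 : ℝ) ≤ numSat n L k := Nat.cast_nonneg _
  calc 2 ^ n * 2 ^ n * (n.choose k : ℝ) ^ L * (2 ^ L * (n.choose k : ℝ) ^ L)
      = 2 ^ L * (2 ^ n * (n.choose k : ℝ) ^ L) ^ 2 := by ring
    _ ≤ 2 ^ L * (numSat n L k * (2 ^ n * ∑ D, evenCount n k D ^ L)) := by gcongr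
    _ = (numSat n L k * 2 ^ n) * (2 ^ L * ∑ D, evenCount n k D ^ L) := by ring
    _ ≤ (numSat n L k * 2 ^ n) * (2 ^ n * B * (n.choose k : ℝ) ^ L) := by gcongr
    _ = _ := by ring

noncomputable def spin (x : ZMod 2) : ℝ := if x = 0 then 1 else -1

lemma spin_add (x y : ZMod 2) : spin (x + y) = spin x * spin y := by
  have h : (1 : ZMod 2) + 1 = 0 := rfl
  have h01 : ∀ x : ZMod 2, x = 0 ∨ x = 1 := fun x => by
    fin_cases x
    exacts [Or.inl rfl, Or.inr rfl]
  rcases h01 x with rfl | rfl <;> rcases h01 y with rfl | rfl <;> simp [spin, h]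

lemma spin_sq (x : ZMod 2) : spin x ^ 2 = 1 := by
  unfold spin
  split_ifs <;> norm_num

lemma spin_sum {ι : Type*} (D : ι → ZMod 2) (S : Finset ι) :
    spin (∑ j ∈ S, D j) = ∏ j ∈ S, spin (D j) := by
  induction S using Finset.induction_on with
  | empty => simp [spin]
  | insert a S ha ih => rw [sum_insert ha, prod_insert ha, spin_add, ih]

lemma sum_powersetCard_succ_insert_prod {ι : Type*} (f : ι → ℝ) {a : ι} {A : Finset ι}
    (ha : a ∉ A) (k : ℕ) :
    ∑ S ∈ powersetCard (k + 1) (insert a A), ∏ j ∈ S, f j =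
      ∑ S ∈ powersetCard (k + 1) A, ∏ j ∈ S, f j +
        f a * ∑ S ∈ powersetCard k A, ∏ j ∈ S, f j := by
  have hS : ∀ {k : ℕ}, ∀ S ∈ powersetCard k A, a ∉ S :=
    fun S hS h => ha ((mem_powersetCard.1 hS).1 h)
  rw [← Nat.succ_eq_add_one, powersetCard_succ_insert ha, sum_union, sum_image, mul_sum]
  · congr 1
    exact sum_congr rfl fun S h => prod_insert (hS S h)
  · intro S h T h' e
    rw [← erase_insert (hS S h), ← erase_insert (hS T h'), e]
  · rw [disjoint_left]
    intro S h h'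
    obtain ⟨T, -, rfl⟩ := mem_image.1 h'
    exact hS _ h (mem_insert_self _ _)

lemma sum_powersetCard_three_prod {ι : Type*} (f : ι → ℝ) (hf : ∀ j, f j ^ 2 = 1)
    (A : Finset ι) :
    6 * ∑ S ∈ powersetCard 3 A, ∏ j ∈ S, f j =
      (∑ j ∈ A, f j) ^ 3 - (3 * #A - 2) * ∑ j ∈ A, f j := by
  have h1 : ∀ A : Finset ι, ∑ S ∈ powersetCard 1 A, ∏ j ∈ S, f j = ∑ j ∈ A, f j := by
    intro A
    simp [powersetCard_one]
  have h2 : ∀ A : Finset ι, 2 * ∑ S ∈ powersetCard 2 A, ∏ j ∈ S, f j =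
      (∑ j ∈ A, f j) ^ 2 - #A := by
    intro A
    induction A using Finset.induction_on with
    | empty => rw [powersetCard_eq_empty.2 (by simp)]; simp
    | insert a A ha ih =>
      rw [sum_powersetCard_succ_insert_prod f ha, mul_add, ih, h1, sum_insert ha,
        card_insert_of_notMem ha]
      push_cast
      linear_combination - hf a
  induction A using Finset.induction_on with
  | empty => rw [powersetCard_eq_empty.2 (by simp)]; simp
  | insert a A ha ih =>
    rw [sum_powersetCard_succ_insert_prod f ha, mul_add, ih, sum_insert ha,
      card_insert_of_notMem ha]
    push_cast
    linear_combination 3 * f a * h2 A - (3 * (∑ j ∈ A, f j) + f a) * hf a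

lemma two_mul_evenCount_div {n : ℕ} (hn : 3 ≤ n) (D : Fin n → ZMod 2) :
    2 * evenCount n 3 D / n.choose 3 = 1 +
      ((∑ j, spin (D j)) ^ 3 - (3 * n - 2) * ∑ j, spin (D j)) / (n * (n - 1) * (n - 2)) := by
  have hC : (6 : ℝ) * n.choose 3 = n * (n - 1) * (n - 2) := by
    have := Nat.cast_choose_eq_ascPochhammer_div ℝ n 3
    rw [this]
    have h3 : ((n - 2 : ℕ) : ℝ) = n - 2 := by
      rw [Nat.cast_sub (by omega)]; norm_num
    simp [ascPochhammer_succ_right, Nat.factorial, h3]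
    ring
  have h0 : (n.choose 3 : ℝ) ≠ 0 := by
    exact_mod_cast (Nat.choose_pos hn).ne'
  have he : 2 * evenCount n 3 D = n.choose 3 +
      ∑ S ∈ powersetCard 3 univ, ∏ j ∈ S, spin (D j) := by
    have hx : ∀ x : ZMod 2, 2 * (if x = 0 then (1 : ℝ) else 0) = 1 + spin x := by
      intro x
      unfold spin
      split_ifs <;> norm_num
    have hs : ∑ S ∈ powersetCard 3 univ, ∏ j ∈ S, spin (D j) =
        ∑ S : {S : Finset (Fin n) // S.card = 3}, ∏ j ∈ S.1, spin (D j) :=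
      Finset.sum_subtype _ (by simp) _
    rw [hs, evenCount, mul_sum]
    simp only [hx, ← spin_sum, sum_add_distrib]
    simp
  have h3 := sum_powersetCard_three_prod (fun j => spin (D j)) (fun j => spin_sq _) univ
  rw [he, add_div, div_self h0, ← hC]
  rw [Finset.card_univ, Fintype.card_fin] at h3
  rw [← h3]
  field_simp
noncomputable def relEntropy (u : ℝ) : ℝ :=
  (1 + u) / 2 * Real.log (1 + u) + (1 - u) / 2 * Real.log (1 - u)

lemma hasDerivAt_relEntropy {u : ℝ} (h0 : -1 < u) (h1 : u < 1) :
    HasDerivAt relEntropy ((Real.log (1 + u) - Real.log (1 - u)) / 2) u := by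
  have hp : HasDerivAt (fun x : ℝ => 1 + x) 1 u := by simpa using (hasDerivAt_id u).const_add 1
  have hm : HasDerivAt (fun x : ℝ => 1 - x) (-1) u := by simpa using (hasDerivAt_id u).const_sub 1
  have h2 : 1 + u ≠ 0 := by linarith
  have h3 : 1 - u ≠ 0 := by linarith
  have := ((hp.div_const 2).mul (hp.log h2)).add ((hm.div_const 2).mul (hm.log h3))
  refine HasDerivAt.congr_deriv (f := relEntropy) this ?_
  field_simp
  ring

lemma nonneg_of_hasDerivAt_nonneg {f f' : ℝ → ℝ} {b : ℝ} (h0 : 0 ≤ f 0)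
    (hf : ∀ x, 0 ≤ x → x < b → HasDerivAt f (f' x) x) (hf' : ∀ x, 0 ≤ x → x < b → 0 ≤ f' x)
    {x : ℝ} (hx : 0 ≤ x) (hxb : x < b) : 0 ≤ f x := by
  have hm : MonotoneOn f (Set.Ico 0 b) := by
    refine monotoneOn_of_deriv_nonneg (convex_Ico 0 b)
      (fun y hy => (hf y hy.1 hy.2).continuousAt.continuousWithinAt) ?_ ?_
    · intro y hy
      rw [interior_Ico] at hy
      exact (hf y hy.1.le hy.2).differentiableAt.differentiableWithinAt
    · intro y hy
      rw [interior_Ico] at hy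
      rw [(hf y hy.1.le hy.2).deriv]
      exact hf' y hy.1.le hy.2
  exact h0.trans (hm ⟨le_rfl, hx.trans_lt hxb⟩ ⟨hx, hxb⟩ hx)

lemma le_relEntropy {u : ℝ} (h0 : 0 ≤ u) (h1 : u < 1) :
    u ^ 2 / 2 + u ^ 4 / 12 + u ^ 6 / 30 ≤ relEntropy u := by
  have := nonneg_of_hasDerivAt_nonneg (b := 1)
    (f := fun x => relEntropy x - (x ^ 2 / 2 + x ^ 4 / 12 + x ^ 6 / 30))
    (f' := fun x => (Real.log (1 + x) - Real.log (1 - x)) / 2 - (x + x ^ 3 / 3 + x ^ 5 / 5))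
    (by simp [relEntropy]) ?_ ?_ h0 h1
  · linarith
  · intro x hx hx1
    refine (hasDerivAt_relEntropy (by linarith) hx1).sub ?_
    refine ((((hasDerivAt_pow 2 x).div_const 2).add ((hasDerivAt_pow 4 x).div_const 12)).add
      ((hasDerivAt_pow 6 x).div_const 30)).congr_deriv ?_
    norm_num
    ring
  · intro x hx hx1
    have := Real.sum_range_le_log_div hx hx1 3
    rw [Real.log_div (by linarith) (by linarith)] at this
    norm_num [Finset.sum_range_succ] at this
    linarith

lemma log_one_add_le_pade {v : ℝ} (h0 : 0 ≤ v) :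
    Real.log (1 + v) ≤ v * (6 + v) / (6 + 4 * v) := by
  have := nonneg_of_hasDerivAt_nonneg (b := v + 1)
    (f := fun x => x * (6 + x) / (6 + 4 * x) - Real.log (1 + x))
    (f' := fun x => 4 * x ^ 3 / ((6 + 4 * x) ^ 2 * (1 + x)))
    (by simp) ?_ ?_ h0 (by linarith)
  · linarith
  · intro x hx hx1
    have hi := hasDerivAt_id x
    have h2 : (1 : ℝ) + id x ≠ 0 := by simp; linarith
    have h3 : (6 : ℝ) + 4 * id x ≠ 0 := by simp; linarith
    refine (((hi.mul (hi.const_add 6)).div ((hi.const_mul 4).const_add 6) h3).sub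
      ((hi.const_add 1).log h2)).congr_deriv ?_
    simp only [id, Pi.mul_apply] at *
    field_simp
    ring
  · intro x hx hx1
    positivity

lemma gap_of_le_seven_tenths {u : ℝ} (h0 : 0 ≤ u) (h1 : u ≤ 7 / 10) :
    u ^ 2 / 10 ^ 6 ≤ relEntropy u - 0.88949 * Real.log (1 + u ^ 3) := by
  have hE := le_relEntropy h0 (by linarith)
  have hL := log_one_add_le_pade (pow_nonneg h0 3)
  have hpos : 0 < 6 + 4 * u ^ 3 := by positivity
  have key : 0.88949 * (u ^ 3 * (6 + u ^ 3) / (6 + 4 * u ^ 3)) ≤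
      u ^ 2 / 2 + u ^ 4 / 12 + u ^ 6 / 30 - u ^ 2 / 10 ^ 6 := by
    rw [← mul_div_assoc, div_le_iff₀ hpos]
    have hp : 0 ≤ (1 / 2 + u ^ 2 / 12 + u ^ 4 / 30 - 1 / 10 ^ 6) * (6 + 4 * u ^ 3)
        - 0.88949 * (u * (6 + u ^ 3)) := by
      have e4 : 0 ≤ u ^ 5 := by positivity
      have e7 : 0 ≤ u ^ 7 := by positivity
      nlinarith [mul_nonneg h0 (sub_nonneg.2 h1), sq_nonneg (u - 7 / 10),
        mul_nonneg h0 (sq_nonneg (u - 7 / 10)), sq_nonneg (u ^ 2 - u * (7 / 10)),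
        sq_nonneg (u ^ 2 - (7 / 10) ^ 2),
        mul_nonneg (pow_nonneg h0 3) (sub_nonneg.2 h1)]
    nlinarith [mul_nonneg (sq_nonneg u) hp]
  nlinarith

lemma log_bounds {y : ℝ} (hy : 1 ≤ y) (n : ℕ) :
    2 * ∑ i ∈ range n, ((y - 1) / (y + 1)) ^ (2 * i + 1) / (2 * i + 1) ≤ Real.log y ∧
      Real.log y ≤ 2 * (∑ i ∈ range n, ((y - 1) / (y + 1)) ^ (2 * i + 1) / (2 * i + 1) +
        ((y - 1) / (y + 1)) ^ (2 * n + 1) / (1 - ((y - 1) / (y + 1)) ^ 2)) := by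
  have h0 : 0 ≤ (y - 1) / (y + 1) := div_nonneg (by linarith) (by linarith)
  have h1 : (y - 1) / (y + 1) < 1 := by rw [div_lt_one] <;> linarith
  have h2 : (1 + (y - 1) / (y + 1)) / (1 - (y - 1) / (y + 1)) = y := by
    have : y + 1 ≠ 0 := by linarith
    field_simp
    ring
  have hl := Real.sum_range_le_log_div h0 h1 n
  have hu := Real.log_div_le_sum_range_add h0 h1 n
  rw [h2] at hl hu
  constructor <;> linarith

lemma log_numerics :
    0.5988365 < Real.log 1.82 ∧ Real.log 1.82 < 0.5988366 ∧
    -1.7147985 < Real.log 0.18 ∧ Real.log 0.18 < -1.7147984 ∧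
    Real.log 1.551368 < 0.4391372 := by
  have h1 := log_bounds (y := 1.82) (by norm_num) 8
  have h2 := log_bounds (y := 1.2) (by norm_num) 5
  have h3 := log_bounds (y := 1.551368) (by norm_num) 7
  have h4 := Real.log_two_gt_d9
  have h5 := Real.log_two_lt_d9
  have h6 : Real.log 0.18 = 2 * Real.log 1.2 - 3 * Real.log 2 := by
    rw [show (0.18 : ℝ) = 1.2 ^ 2 / 2 ^ 3 by norm_num, Real.log_div (by norm_num) (by norm_num),
      Real.log_pow, Real.log_pow]
    norm_num
  norm_num [Finset.sum_range_succ] at h1 h2 h3 h4 h5 h6 ⊢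
  refine ⟨?_, ?_, ?_, ?_, ?_⟩ <;> linarith

noncomputable def gap (u : ℝ) : ℝ := relEntropy u - 0.88949 * Real.log (1 + u ^ 3)

noncomputable def gapDeriv (u : ℝ) : ℝ :=
  (Real.log (1 + u) - Real.log (1 - u)) / 2 - 0.88949 * (3 * u ^ 2 / (1 + u ^ 3))

lemma hasDerivAt_gap {u : ℝ} (h0 : 0 ≤ u) (h1 : u < 1) : HasDerivAt gap (gapDeriv u) u := by
  refine (hasDerivAt_relEntropy (by linarith) h1).sub (HasDerivAt.const_mul _ ?_)
  refine (((hasDerivAt_pow 3 u).const_add 1).log (by positivity)).congr_deriv ?_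
  norm_num

lemma hasDerivAt_gapDeriv {u : ℝ} (h0 : 0 ≤ u) (h1 : u < 1) :
    HasDerivAt gapDeriv
      (1 / (1 - u ^ 2) - 0.88949 * (3 * (2 * u - u ^ 4) / (1 + u ^ 3) ^ 2)) u := by
  have hp : HasDerivAt (fun x : ℝ => 1 + x) 1 u := by simpa using (hasDerivAt_id u).const_add 1
  have hm : HasDerivAt (fun x : ℝ => 1 - x) (-1) u := by simpa using (hasDerivAt_id u).const_sub 1
  have h2 : 1 + u ≠ 0 := by linarith
  have h3 : 1 - u ≠ 0 := by linarith
  have h4 : 1 + u ^ 3 ≠ 0 := by positivity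
  have h5 : 1 - u ^ 2 ≠ 0 := by nlinarith
  have hl : HasDerivAt (fun x => (Real.log (1 + x) - Real.log (1 - x)) / 2) (1 / (1 - u ^ 2)) u := by
    refine (((hp.log h2).sub (hm.log h3)).div_const 2).congr_deriv ?_
    field_simp
    ring
  refine hl.sub (HasDerivAt.const_mul _ ?_)
  refine (((hasDerivAt_pow 2 u).const_mul 3).div ((hasDerivAt_pow 3 u).const_add 1) h4).congr_deriv ?_
  norm_num
  field_simp
  ring

lemma gap_eighty_two : 1.2 / 10 ^ 6 ≤ gap 0.82 := by
  obtain ⟨h1, h2, h3, h4, h5⟩ := log_numerics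
  norm_num [gap, relEntropy] at *
  linarith

lemma abs_gapDeriv_eighty_two : |gapDeriv 0.82| ≤ 3 / 10 ^ 4 := by
  obtain ⟨h1, h2, h3, h4, h5⟩ := log_numerics
  rw [abs_le]
  norm_num [gapDeriv] at *
  constructor <;> linarith

lemma monotoneOn_gapDeriv_sub_id : MonotoneOn (fun x => gapDeriv x - x) (Set.Ico 0.8 1) := by
  have hd : ∀ y ∈ Set.Ico (0.8 : ℝ) 1, HasDerivAt (fun x => gapDeriv x - x)
      (1 / (1 - y ^ 2) - 0.88949 * (3 * (2 * y - y ^ 4) / (1 + y ^ 3) ^ 2) - 1) y := fun y hy =>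
    (hasDerivAt_gapDeriv (by linarith [hy.1]) hy.2).sub (hasDerivAt_id y)
  refine monotoneOn_of_deriv_nonneg (convex_Ico _ _)
    (fun y hy => (hd y hy).continuousAt.continuousWithinAt)
    (fun y hy => (hd y (interior_subset hy)).differentiableAt.differentiableWithinAt) ?_
  intro y hy
  have hy' := interior_subset hy
  rw [(hd y hy').deriv]
  obtain ⟨hy0, hy1⟩ := hy'
  have hy3 : (0.8 : ℝ) ^ 3 ≤ y ^ 3 := pow_le_pow_left₀ (by norm_num) hy0 3
  have hy2 : (0.8 : ℝ) ^ 2 ≤ y ^ 2 := pow_le_pow_left₀ (by norm_num) hy0 2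
  have hp2 : 0 < 1 - y ^ 2 := by nlinarith
  have hp3 : y ^ 3 < 1 := by nlinarith
  have e1 : (1.5 : ℝ) ^ 2 ≤ (1 + y ^ 3) ^ 2 := pow_le_pow_left₀ (by norm_num) (by linarith) 2
  have e2 : (2 - y ^ 3) * (1 - y ^ 2) ≤ 1.488 * 0.36 := by
    apply mul_le_mul <;> linarith
  have e3 : 1.8 ≤ y * (1 + y ^ 3) ^ 2 := by nlinarith
  have : 1 / (1 - y ^ 2) - 0.88949 * (3 * (2 * y - y ^ 4) / (1 + y ^ 3) ^ 2) - 1 =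
      y * (y * (1 + y ^ 3) ^ 2 - 0.88949 * 3 * ((2 - y ^ 3) * (1 - y ^ 2))) /
        ((1 - y ^ 2) * (1 + y ^ 3) ^ 2) := by
    have : 1 + y ^ 3 ≠ 0 := by linarith
    field_simp
    ring
  rw [this]
  apply div_nonneg
  · apply mul_nonneg <;> linarith
  · positivity

lemma gap_of_eight_tenths_le {u : ℝ} (h0 : 0.8 ≤ u) (h1 : u < 1) : 1.1 / 10 ^ 6 ≤ gap u := by
  have hmono := monotoneOn_gapDeriv_sub_id
  have hd : ∀ y ∈ Set.Ico (0.8 : ℝ) 1,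
      HasDerivAt (fun x => gap x - gapDeriv 0.82 * (x - 0.82) - (x - 0.82) ^ 2 / 2)
        ((gapDeriv y - y) - (gapDeriv 0.82 - 0.82)) y := by
    intro y hy
    have hi := (hasDerivAt_id y).sub_const 0.82
    refine (((hasDerivAt_gap (by linarith [hy.1]) hy.2).sub (hi.const_mul _)).sub
      ((hi.pow 2).div_const 2)).congr_deriv ?_
    simp
    ring
  have hmem : (0.82 : ℝ) ∈ Set.Ico (0.8 : ℝ) 1 := by norm_num
  have hle : gap 0.82 ≤ gap u - gapDeriv 0.82 * (u - 0.82) - (u - 0.82) ^ 2 / 2 := by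
    rcases le_total 0.82 u with h | h
    · have hs : Set.Ico (0.82 : ℝ) 1 ⊆ Set.Ico 0.8 1 := Set.Ico_subset_Ico_left (by norm_num)
      have := monotoneOn_of_deriv_nonneg (convex_Ico (0.82 : ℝ) 1)
        (fun y hy => (hd y (hs hy)).continuousAt.continuousWithinAt)
        (fun y hy => (hd y (hs (interior_subset hy))).differentiableAt.differentiableWithinAt)
        (fun y hy => by
          have hy' := interior_subset hy
          rw [(hd y (hs hy')).deriv]
          exact sub_nonneg.2 (hmono hmem (hs hy') hy'.1))
        ⟨le_rfl, by norm_num⟩ ⟨h, h1⟩ h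
      simpa using this
    · have hs : Set.Icc (0.8 : ℝ) 0.82 ⊆ Set.Ico 0.8 1 :=
        fun y hy => ⟨hy.1, hy.2.trans_lt (by norm_num)⟩
      have := antitoneOn_of_deriv_nonpos (convex_Icc (0.8 : ℝ) 0.82)
        (fun y hy => (hd y (hs hy)).continuousAt.continuousWithinAt)
        (fun y hy => (hd y (hs (interior_subset hy))).differentiableAt.differentiableWithinAt)
        (fun y hy => by
          have hy' := interior_subset hy
          rw [(hd y (hs hy')).deriv]
          exact sub_nonpos.2 (hmono (hs hy') hmem hy'.2))
        ⟨h0, h⟩ ⟨by norm_num, le_rfl⟩ h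
      simpa using this
  have h2 := gap_eighty_two
  have h3 := abs_le.1 abs_gapDeriv_eighty_two
  nlinarith [sq_nonneg (gapDeriv 0.82 + (u - 0.82))]

lemma gap_of_mem_Icc {u : ℝ} (h0 : 0.7 ≤ u) (h1 : u ≤ 0.8) : 1.1 / 10 ^ 6 ≤ gap u := by
  have hmono : MonotoneOn gapDeriv (Set.Ico 0.7 1) := by
    have hd : ∀ y ∈ Set.Ico (0.7 : ℝ) 1, HasDerivAt gapDeriv
        (1 / (1 - y ^ 2) - 0.88949 * (3 * (2 * y - y ^ 4) / (1 + y ^ 3) ^ 2)) y := fun y hy =>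
      hasDerivAt_gapDeriv (by linarith [hy.1]) hy.2
    refine monotoneOn_of_deriv_nonneg (convex_Ico _ _)
      (fun y hy => (hd y hy).continuousAt.continuousWithinAt)
      (fun y hy => (hd y (interior_subset hy)).differentiableAt.differentiableWithinAt) ?_
    intro y hy
    have hy' := interior_subset hy
    rw [(hd y hy').deriv]
    obtain ⟨hy0, hy1⟩ := hy'
    have hy3 : (0.7 : ℝ) ^ 3 ≤ y ^ 3 := pow_le_pow_left₀ (by norm_num) hy0 3
    have hy2 : (0.7 : ℝ) ^ 2 ≤ y ^ 2 := pow_le_pow_left₀ (by norm_num) hy0 2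
    have hp2 : 0 < 1 - y ^ 2 := by nlinarith
    have hp3 : y ^ 3 < 1 := by nlinarith
    have e1 : (1.343 : ℝ) ^ 2 ≤ (1 + y ^ 3) ^ 2 := pow_le_pow_left₀ (by norm_num) (by linarith) 2
    have e0 : 2 * y - y ^ 4 ≤ 1.2 := by nlinarith [sq_nonneg (y ^ 2 - 0.63), sq_nonneg (y - 0.79)]
    have e2 : (2 * y - y ^ 4) * (1 - y ^ 2) ≤ 1.2 * 0.51 := by
      apply mul_le_mul <;> linarith
    have : 1 / (1 - y ^ 2) - 0.88949 * (3 * (2 * y - y ^ 4) / (1 + y ^ 3) ^ 2) =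
        ((1 + y ^ 3) ^ 2 - 0.88949 * 3 * ((2 * y - y ^ 4) * (1 - y ^ 2))) /
          ((1 - y ^ 2) * (1 + y ^ 3) ^ 2) := by
      have : 1 + y ^ 3 ≠ 0 := by linarith
      field_simp
    rw [this]
    apply div_nonneg
    · linarith
    · positivity
  have hneg : gapDeriv 0.8 ≤ 0 := by
    have h1 := monotoneOn_gapDeriv_sub_id (a := 0.8) (by norm_num) (b := 0.82) (by norm_num)
      (by norm_num)
    have h2 := (abs_le.1 abs_gapDeriv_eighty_two).2
    norm_num at *
    linarith
  have hd : ∀ y ∈ Set.Icc (0.7 : ℝ) 0.8, HasDerivAt gap (gapDeriv y) y := fun y hy =>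
    hasDerivAt_gap (by linarith [hy.1]) (by linarith [hy.2])
  have := antitoneOn_of_deriv_nonpos (convex_Icc (0.7 : ℝ) 0.8)
    (fun y hy => (hd y hy).continuousAt.continuousWithinAt)
    (fun y hy => (hd y (interior_subset hy)).differentiableAt.differentiableWithinAt)
    (fun y hy => by
      have hy' := interior_subset hy
      rw [(hd y hy').deriv]
      exact (hmono ⟨hy'.1, by linarith [hy'.2]⟩ (by norm_num) hy'.2).trans hneg)
    ⟨h0, h1⟩ ⟨by norm_num, le_rfl⟩ h1
  exact (gap_of_eight_tenths_le le_rfl (by norm_num)).trans this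

lemma sq_le_gap {u : ℝ} (h0 : 0 ≤ u) (h1 : u ≤ 1) : u ^ 2 / 10 ^ 6 ≤ gap u := by
  have hu : u ^ 2 ≤ 1 := pow_le_one₀ h0 h1
  rcases le_total u (7 / 10) with h | h
  · exact gap_of_le_seven_tenths h0 h
  rcases le_total u 0.8 with h' | h'
  · have := gap_of_mem_Icc (by linarith) h'
    linarith
  rcases h1.lt_or_eq with h1 | rfl
  · have := gap_of_eight_tenths_le h' h1
    linarith
  · have := Real.log_two_gt_d9
    norm_num [gap, relEntropy] at *
    linarith

/-- The ratio of the second moment to the square of the first moment for one clause, for two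
assignments whose pointwise spin products sum to `s`. -/
noncomputable def pairCorrelation (n s : ℝ) : ℝ :=
  1 + (s ^ 3 - (3 * n - 2) * s) / (n * (n - 1) * (n - 2))

lemma pairCorrelation_le_of_nonneg {n s : ℝ} (hn : 5 ≤ n) (h0 : 0 ≤ s) :
    pairCorrelation n s ≤ (1 + (s / n) ^ 3) * (1 + 6 / n) := by
  have hd : 0 < n * (n - 1) * (n - 2) :=
    mul_pos (mul_pos (by linarith) (by linarith)) (by linarith)
  have hn0 : 0 < n := by linarith
  have h1 : (s ^ 3 - (3 * n - 2) * s) / (n * (n - 1) * (n - 2)) ≤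
      s ^ 3 / (n * (n - 1) * (n - 2)) := by
    gcongr
    nlinarith
  have h2 : s ^ 3 / (n * (n - 1) * (n - 2)) ≤ (s / n) ^ 3 * (1 + 6 / n) := by
    have : (s / n) ^ 3 * (1 + 6 / n) = s ^ 3 * ((n + 6) / n ^ 4) := by
      field_simp
    rw [this, div_eq_mul_inv]
    gcongr
    rw [inv_eq_one_div, div_le_div_iff₀ hd (by positivity)]
    nlinarith [mul_nonneg hn0.le (mul_nonneg hn0.le (sub_nonneg.2 hn)),
      mul_nonneg hn0.le (sub_nonneg.2 hn)]
  have h3 : 0 ≤ 6 / n := by positivity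
  unfold pairCorrelation
  nlinarith

lemma pairCorrelation_pow_le {n s : ℝ} {L : ℕ} (hn : 5 ≤ n) (hL : L ≤ 0.88949 * n) (h0 : 0 ≤ s)
    (hp : 0 ≤ pairCorrelation n s) :
    pairCorrelation n s ^ L ≤
      Real.exp 6 * Real.exp (n * (0.88949 * Real.log (1 + (s / n) ^ 3))) := by
  have hn0 : 0 < n := by linarith
  have hu : 0 ≤ (s / n) ^ 3 := by positivity
  have hlog : 0 ≤ Real.log (1 + (s / n) ^ 3) := Real.log_nonneg (by linarith)
  calc pairCorrelation n s ^ L ≤ ((1 + (s / n) ^ 3) * (1 + 6 / n)) ^ L := by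
        gcongr
        exact pairCorrelation_le_of_nonneg hn h0
    _ = (1 + 6 / n) ^ L * (1 + (s / n) ^ 3) ^ L := by rw [mul_pow, mul_comm]
    _ ≤ Real.exp (6 / n) ^ L * Real.exp (Real.log (1 + (s / n) ^ 3)) ^ L := by
        rw [Real.exp_log (by linarith)]
        gcongr
        linarith [Real.add_one_le_exp (6 / n)]
    _ = Real.exp (L * (6 / n)) * Real.exp (L * Real.log (1 + (s / n) ^ 3)) := by
        rw [← Real.exp_nat_mul, ← Real.exp_nat_mul]
    _ ≤ _ := by
        rw [← mul_assoc (n : ℝ), mul_comm (n : ℝ)]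
        gcongr
        rw [mul_div_assoc', div_le_iff₀ hn0]
        nlinarith

lemma pairCorrelation_le_of_le_cube {r s : ℝ} (hr : 1 ≤ r) (hn : 6 ≤ r ^ 5) (hs : s ≤ r ^ 3) :
    pairCorrelation (r ^ 5) s ≤ 1 + 12 / r ^ 6 := by
  have hr0 : 0 < r := by linarith
  have hd : r ^ 15 / 2 ≤ r ^ 5 * (r ^ 5 - 1) * (r ^ 5 - 2) := by
    set n := r ^ 5
    have : r ^ 15 = n ^ 3 := by simp only [n]; ring
    rw [this]
    nlinarith [mul_nonneg (show 0 ≤ n by linarith) (mul_nonneg (show 0 ≤ n by linarith)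
      (sub_nonneg.2 hn))]
  have hd0 : 0 < r ^ 15 / 2 := by positivity
  unfold pairCorrelation
  gcongr 1 + ?_
  have hnum : s ^ 3 - (3 * r ^ 5 - 2) * s ≤ 6 * r ^ 9 := by
    have h9 : 0 ≤ r ^ 9 := by positivity
    rcases le_total 0 s with h | h
    · have : s ^ 3 ≤ (r ^ 3) ^ 3 := pow_le_pow_left₀ h hs 3
      nlinarith
    · by_cases hc : s ^ 2 ≤ 3 * r ^ 5
      · have h6 : r ^ 5 ≤ r ^ 6 := pow_le_pow_right₀ hr (by norm_num)
        have hs2 : -s ≤ 2 * r ^ 3 := abs_le_of_sq_le_sq' (by nlinarith) (by positivity) |>.2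
        have h8 : r ^ 8 ≤ r ^ 9 := pow_le_pow_right₀ hr (by norm_num)
        have : s ^ 3 ≤ 0 := by nlinarith [sq_nonneg s]
        have h5 : r ^ 5 * (-s) ≤ r ^ 5 * (2 * r ^ 3) := by gcongr
        nlinarith
      · push Not at hc
        nlinarith
  rw [div_le_div_iff₀ (hd0.trans_le hd) (by positivity)]
  calc (s ^ 3 - (3 * r ^ 5 - 2) * s) * r ^ 6 ≤ 6 * r ^ 9 * r ^ 6 := by gcongr
    _ = 12 * (r ^ 15 / 2) := by ring
    _ ≤ _ := by gcongr

lemma sum_spin {n : ℕ} (D : Fin n → ZMod 2) :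
    ∑ j, spin (D j) = n - 2 * #{j | D j ≠ 0} := by
  have : ∀ x : ZMod 2, spin x = 1 - 2 * (if x ≠ 0 then 1 else 0) := by
    intro x
    unfold spin
    by_cases hx : x = 0 <;> norm_num [hx]
  simp only [this, sum_sub_distrib, ← mul_sum, sum_boole]
  simp

lemma card_weight_mul_le (n w : ℕ) {u : ℝ} (h0 : 0 ≤ u) (h1 : u ≤ 1) :
    (#{D : Fin n → ZMod 2 | #{j | D j ≠ 0} = w} : ℝ) * ((1 + u) ^ (n - w) * (1 - u) ^ w) ≤
      2 ^ n := by
  have hz : ∑ x : ZMod 2, (if x ≠ 0 then 1 - u else 1 + u) = 2 := by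
    have : (univ : Finset (ZMod 2)) = {0, 1} := rfl
    rw [this, sum_pair (by simp)]
    norm_num
  have hprod : ∀ D : Fin n → ZMod 2, ∏ j, (if D j ≠ 0 then 1 - u else 1 + u) =
      (1 + u) ^ (n - #{j | D j ≠ 0}) * (1 - u) ^ #{j | D j ≠ 0} := by
    intro D
    have hc := card_filter_add_card_filter_not (s := (univ : Finset (Fin n))) (fun j => D j ≠ 0)
    rw [card_univ, Fintype.card_fin] at hc
    rw [prod_ite, prod_const, prod_const, mul_comm]
    congr 2
    omega
  calc _ = ∑ D : Fin n → ZMod 2 with #{j | D j ≠ 0} = w,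
        ∏ j, (if D j ≠ 0 then 1 - u else 1 + u) := by
        rw [← nsmul_eq_mul]
        refine (sum_eq_card_nsmul fun D hD => ?_).symm
        rw [hprod, (mem_filter.1 hD).2]
    _ ≤ ∑ D : Fin n → ZMod 2, ∏ j, (if D j ≠ 0 then 1 - u else 1 + u) := by
        refine sum_le_sum_of_subset_of_nonneg (filter_subset _ _) fun D _ _ =>
          prod_nonneg fun j _ => ?_
        split_ifs <;> linarith
    _ = 2 ^ n := by
        rw [← hz, Fintype.sum_pow]

lemma pow_mul_pow_eq_exp_relEntropy {n w : ℕ} (hn : 0 < n) (hw : 2 * w < n) :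
    (1 + ((n : ℝ) - 2 * w) / n) ^ (n - w) * (1 - ((n : ℝ) - 2 * w) / n) ^ w =
      Real.exp (n * relEntropy ((n - 2 * w) / n)) := by
  have hn' : (0 : ℝ) < n := by exact_mod_cast hn
  have hw' : 2 * (w : ℝ) < n := by exact_mod_cast hw
  set u : ℝ := ((n : ℝ) - 2 * w) / n with hu
  have hu0 : 0 < u := div_pos (by linarith) hn'
  have e1 : (n : ℝ) * ((1 + u) / 2) = n - w := by rw [hu]; field_simp; ring
  have e2 : (n : ℝ) * ((1 - u) / 2) = w := by rw [hu]; field_simp; ring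
  have e : (n : ℝ) * relEntropy u =
      ((n - w : ℕ) : ℝ) * Real.log (1 + u) + w * Real.log (1 - u) := by
    rw [Nat.cast_sub (by omega), ← e1, relEntropy]
    linear_combination Real.log (1 - u) * e2
  rw [e, Real.exp_add, Real.exp_nat_mul, Real.exp_nat_mul, Real.exp_log (by linarith)]
  rcases Nat.eq_zero_or_pos w with rfl | hwpos
  · simp
  · have hwpos' : (0 : ℝ) < w := by exact_mod_cast hwpos
    rw [Real.exp_log (by nlinarith)]

lemma sum_pairCorrelation_weight_le {n L w : ℕ} (hn : 5 ≤ n) (hL : L ≤ 0.88949 * (n : ℝ))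
    (hw : 2 * w < n) (hp : 0 ≤ pairCorrelation n (n - 2 * w)) :
    (#{D : Fin n → ZMod 2 | #{j | D j ≠ 0} = w} : ℝ) * pairCorrelation n (n - 2 * w) ^ L ≤
      2 ^ n * (Real.exp 6 * Real.exp (-((n - 2 * w) ^ 2 / (10 ^ 6 * n)))) := by
  have hn' : (5 : ℝ) ≤ n := by exact_mod_cast hn
  have hw' : 2 * (w : ℝ) < n := by exact_mod_cast hw
  have hn0 : (0 : ℝ) < n := by linarith
  have hw0 : (0 : ℝ) ≤ w := Nat.cast_nonneg w
  have hpow := pairCorrelation_pow_le hn' hL (by linarith) hp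
  have hu0 : 0 ≤ ((n : ℝ) - 2 * w) / n := div_nonneg (by linarith) hn0.le
  have hu1 : ((n : ℝ) - 2 * w) / n ≤ 1 := by rw [div_le_one hn0]; linarith
  have hcard := card_weight_mul_le n w hu0 hu1
  rw [pow_mul_pow_eq_exp_relEntropy (by omega) hw] at hcard
  have hgap := sq_le_gap hu0 hu1
  set u : ℝ := ((n : ℝ) - 2 * w) / n with hu
  have hexp : (n : ℝ) * (0.88949 * Real.log (1 + u ^ 3)) ≤
      n * relEntropy u + -((n - 2 * w) ^ 2 / (10 ^ 6 * n)) := by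
    have h2 : ((n : ℝ) - 2 * w) ^ 2 / (10 ^ 6 * n) = n * (u ^ 2 / 10 ^ 6) := by
      rw [hu]
      field_simp
    rw [h2]
    unfold gap at hgap
    nlinarith
  calc _ ≤ (#{D : Fin n → ZMod 2 | #{j | D j ≠ 0} = w} : ℝ) * (Real.exp 6 *
        Real.exp (n * relEntropy u + -((n - 2 * w) ^ 2 / (10 ^ 6 * n)))) := by
        gcongr
        exact hpow.trans (by gcongr)
    _ = ((#{D : Fin n → ZMod 2 | #{j | D j ≠ 0} = w} : ℝ) * Real.exp (n * relEntropy u)) *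
        (Real.exp 6 * Real.exp (-((n - 2 * w) ^ 2 / (10 ^ 6 * n)))) := by
        rw [Real.exp_add]
        ring
    _ ≤ _ := by gcongr

/-- An upper bound for the normalized second moment, in terms of `r = n ^ (1 / 5)`. -/
noncomputable def secondMomentBound (r : ℝ) : ℝ :=
  Real.exp (12 / r) + (r ^ 5 + 1) * (Real.exp 6 * Real.exp (-(r / 10 ^ 6)))

lemma sum_evenCount_pow_le {n L : ℕ} {r : ℝ} (hr : 1 ≤ r) (hrn : r ^ 5 = n) (hn : 6 ≤ n)
    (hL : L ≤ 0.88949 * (n : ℝ)) :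
    ∑ D, (2 * evenCount n 3 D / n.choose 3) ^ L ≤ 2 ^ n * secondMomentBound r := by
  have hr0 : 0 < r := by linarith
  have heq : ∀ D : Fin n → ZMod 2, 2 * evenCount n 3 D / n.choose 3 =
      pairCorrelation n (∑ j, spin (D j)) := fun D => two_mul_evenCount_div (by omega) D
  have hnonneg : ∀ D : Fin n → ZMod 2, 0 ≤ pairCorrelation n (∑ j, spin (D j)) := fun D => by
    rw [← heq]
    have := evenCount_nonneg (k := 3) D
    positivity
  simp only [heq]
  have hn6 : (6 : ℝ) ≤ r ^ 5 := by rw [hrn]; exact_mod_cast hn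
  rw [← sum_filter_add_sum_filter_not univ (fun D : Fin n → ZMod 2 => ∑ j, spin (D j) ≤ r ^ 3),
    secondMomentBound, mul_add]
  refine add_le_add ?_ ?_
  · have hterm : ∀ D ∈ ({D | ∑ j, spin (D j) ≤ r ^ 3} : Finset (Fin n → ZMod 2)),
        pairCorrelation n (∑ j, spin (D j)) ^ L ≤ Real.exp (12 / r) := by
      intro D hD
      have h1 := pairCorrelation_le_of_le_cube hr hn6 (mem_filter.1 hD).2
      rw [hrn] at h1
      calc pairCorrelation n (∑ j, spin (D j)) ^ L ≤ Real.exp (12 / r ^ 6) ^ L := by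
            refine pow_le_pow_left₀ (hnonneg D) (h1.trans ?_) L
            linarith [Real.add_one_le_exp (12 / r ^ 6)]
        _ = Real.exp (L * (12 / r ^ 6)) := by rw [← Real.exp_nat_mul]
        _ ≤ Real.exp (12 / r) := by
            gcongr
            have : 12 / r = r ^ 5 * (12 / r ^ 6) := by field_simp
            rw [this, hrn]
            have : (0 : ℝ) ≤ n := Nat.cast_nonneg n
            exact mul_le_mul_of_nonneg_right (by linarith) (by positivity)
    refine (sum_le_card_nsmul _ _ _ hterm).trans ?_
    rw [nsmul_eq_mul]
    gcongr
    have : #({D | ∑ j, spin (D j) ≤ r ^ 3} : Finset (Fin n → ZMod 2)) ≤ 2 ^ n := by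
      refine (card_filter_le _ _).trans ?_
      simp
    exact_mod_cast this
  · rw [← sum_fiberwise_of_maps_to (t := range (n + 1))
      (g := fun D : Fin n → ZMod 2 => #{j | D j ≠ 0})]
    swap
    · intro D _
      rw [mem_range, Nat.lt_succ_iff]
      exact (card_filter_le _ _).trans (by simp)
    have hfib : ∀ w ∈ range (n + 1),
        ∑ D ∈ ({D | ¬ ∑ j, spin (D j) ≤ r ^ 3} : Finset (Fin n → ZMod 2)) with
          #{j | D j ≠ 0} = w, pairCorrelation n (∑ j, spin (D j)) ^ L ≤
        2 ^ n * (Real.exp 6 * Real.exp (-(r / 10 ^ 6))) := by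
      intro w _
      rcases Finset.eq_empty_or_nonempty
        (({D | ¬ ∑ j, spin (D j) ≤ r ^ 3} : Finset (Fin n → ZMod 2)).filter
          (fun D : Fin n → ZMod 2 => #{j | D j ≠ 0} = w)) with he | ⟨D₀, hD₀⟩
      · rw [he, sum_empty]
        positivity
      · obtain ⟨hD₁, hD₂⟩ := mem_filter.1 hD₀
        have hlt := (mem_filter.1 hD₁).2
        have hp := hnonneg D₀
        rw [sum_spin, hD₂, not_le] at hlt
        rw [sum_spin, hD₂] at hp
        have hr3 : 0 < r ^ 3 := by positivity
        have hw : 2 * w < n := by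
          have : 2 * (w : ℝ) < n := by linarith
          exact_mod_cast this
        calc _ ≤ ∑ D : Fin n → ZMod 2 with #{j | D j ≠ 0} = w,
              pairCorrelation n (∑ j, spin (D j)) ^ L :=
              sum_le_sum_of_subset_of_nonneg (filter_subset_filter _ (filter_subset _ _))
                fun D _ _ => pow_nonneg (hnonneg D) L
          _ = (#{D : Fin n → ZMod 2 | #{j | D j ≠ 0} = w} : ℝ) *
              pairCorrelation n (n - 2 * w) ^ L := by
              rw [← nsmul_eq_mul]
              refine sum_eq_card_nsmul fun D hD => ?_
              rw [sum_spin, (mem_filter.1 hD).2]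
          _ ≤ _ := sum_pairCorrelation_weight_le (by omega) hL hw hp
          _ ≤ _ := by
              gcongr _ * (_ * Real.exp (-?_))
              have hsq : (r ^ 3) ^ 2 ≤ ((n : ℝ) - 2 * w) ^ 2 := pow_le_pow_left₀ hr3.le hlt.le 2
              rw [← hrn] at hsq ⊢
              rw [div_le_div_iff₀ (by positivity) (by positivity)]
              nlinarith
    refine (sum_le_card_nsmul _ _ _ hfib).trans (le_of_eq ?_)
    rw [card_range, nsmul_eq_mul, hrn]
    push_cast
    ring

lemma tendsto_secondMomentBound : Tendsto secondMomentBound atTop (nhds 1) := by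
  have h1 : Tendsto (fun r : ℝ => Real.exp (12 / r)) atTop (nhds 1) := by
    have := (Real.continuous_exp.tendsto 0).comp
      (tendsto_const_nhds (x := (12 : ℝ)).div_atTop tendsto_id)
    rw [Real.exp_zero] at this
    exact this
  have h2 : ∀ k : ℕ, Tendsto (fun r : ℝ => r ^ k * Real.exp (-(r / 10 ^ 6))) atTop (nhds 0) := by
    intro k
    have := (Real.tendsto_pow_mul_exp_neg_atTop_nhds_zero k).comp
      (tendsto_id.atTop_div_const (show (0 : ℝ) < 10 ^ 6 by norm_num))
    have := this.const_mul ((10 ^ 6 : ℝ) ^ k)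
    rw [mul_zero] at this
    refine this.congr fun r => ?_
    simp only [Function.comp, id, div_pow]
    field_simp
  have h3 := h1.add (((h2 5).add (h2 0)).mul_const (Real.exp 6))
  rw [add_zero, zero_mul, add_zero] at h3
  refine h3.congr fun r => ?_
  unfold secondMomentBound
  ring

/-- `P_{n,⌊0.88949·n⌋}(3-XOR-SAT) → 1` as `n → ∞`; i.e. `α_3 ≥ 0.88949`. -/
theorem alpha_three_ge :
    Tendsto (fun n : ℕ => Psat n ⌊(0.88949 : ℝ) * n⌋₊ 3) atTop (nhds 1) := by
  have hr : Tendsto (fun n : ℕ => (n : ℝ) ^ (1 / 5 : ℝ)) atTop atTop :=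
    (tendsto_rpow_atTop (by norm_num)).comp tendsto_natCast_atTop_atTop
  have hB : Tendsto (fun n : ℕ => (secondMomentBound ((n : ℝ) ^ (1 / 5 : ℝ)))⁻¹) atTop
      (nhds 1) := by
    simpa using (tendsto_secondMomentBound.comp hr).inv₀ one_ne_zero
  refine tendsto_of_tendsto_of_tendsto_of_le_of_le' hB tendsto_const_nhds ?_ ?_
  · filter_upwards [hr.eventually_ge_atTop 1, eventually_ge_atTop 6] with n hn1 hn6
    refine inv_le_Psat (by omega) ?_ (sum_evenCount_pow_le hn1 ?_ hn6 (Nat.floor_le (by positivity)))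
    · unfold secondMomentBound
      positivity
    · rw [← Real.rpow_natCast, ← Real.rpow_mul (Nat.cast_nonneg n)]
      norm_num
  · exact Eventually.of_forall fun n => div_le_one_of_le₀ (numSat_le _ _ _) (by positivity)
end

section
/- Let k ≥ 3 be an integer and let c be a real number with 0 < c < 1 such that for every x ∈ (0,1/2), c·ln(1+(1−2x)^k) < ln 2 + H(x) (i.e., c < θ_k). Then Σ₂(⌊c·n⌋,k) = 2^{−n} · ∑_{m ≤ n, |m − n/2| ≥ n^{1−4/(3k)}} C(n,m) · (1 + ω_{n,m,k}/C(n,k))^{⌊c·n⌋} tends to 0 as n → ∞. -/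
open Finset Filter

attribute [local instance] Classical.propDecidable

/-- `ω_{n,m,k} = ∑_{s=0}^{k} (−1)^s C(m,s) C(n−m,k−s)`. -/
def omegaW (n m k : ℕ) : ℤ :=
  ∑ s ∈ Finset.range (k + 1), (-1 : ℤ) ^ s * (m.choose s : ℤ) * ((n - m).choose (k - s) : ℤ)

/-- The entropy function `H(x) = x ln x + (1−x) ln(1−x)`. -/
noncomputable def Hent (x : ℝ) : ℝ := x * Real.log x + (1 - x) * Real.log (1 - x)

open Polynomial in
theorem omegaW_eq_coeff (n m k : ℕ) :
    omegaW n m k = ((1 - X : ℤ[X]) ^ m * (1 + X) ^ (n - m)).coeff k := by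
  have h (s : ℕ) : ((1 - X : ℤ[X]) ^ m).coeff s = (-1) ^ s * (m.choose s : ℤ) := by
    have : (1 - X : ℤ[X]) ^ m = ((1 + X : ℤ[X]) ^ m).comp (C (-1) * X) := by
      simp [sub_eq_add_neg]
    rw [this, comp_C_mul_X_coeff, coeff_one_add_X_pow]
    ring
  rw [coeff_mul, Finset.Nat.sum_antidiagonal_eq_sum_range_succ_mk]
  simp [omegaW, h, coeff_one_add_X_pow]

theorem omegaW_one {n m : ℕ} (hm : m ≤ n) : omegaW n m 1 = n - 2 * m := by
  simp [omegaW, Finset.sum_range_succ, hm]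
  ring

open Polynomial in
/-- The three-term recurrence of the binary Krawtchouk polynomials. -/
theorem omegaW_recurrence {n m : ℕ} (hm : m ≤ n) (k : ℕ) :
    ((k : ℤ) + 2) * omegaW n m (k + 2) =
      (n - 2 * m) * omegaW n m (k + 1) - (n - k) * omegaW n m k := by
  obtain ⟨b, rfl⟩ := Nat.exists_eq_add_of_le hm
  simp only [omegaW_eq_coeff, Nat.add_sub_cancel_left]
  set f : ℤ[X] := (1 - X) ^ m * (1 + X) ^ b with hf
  have hder : derivative f - derivative f * X * X =
      C ((b : ℤ) - m) * f - C ((m : ℤ) + b) * (f * X) := by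
    have h1 (a : ℕ) (p : ℤ[X]) : p * derivative (p ^ a) = C (a : ℤ) * p ^ a * derivative p := by
      cases a with
      | zero => simp
      | succ a =>
        rw [derivative_pow]
        simp [pow_succ]
        ring
    have h2 := h1 m (1 - X)
    have h3 := h1 b (1 + X)
    simp only [derivative_sub, derivative_add, derivative_one, derivative_X] at h2 h3
    rw [hf, derivative_mul]
    simp only [C_sub, C_add]
    linear_combination (1 + X) ^ b * (1 + X) * h2 + (1 - X) ^ m * (1 - X) * h3
  have hc := congrArg (fun p => coeff p (k + 1)) hder
  have hX : (derivative f * X * X).coeff (k + 1) = k * f.coeff k := by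
    rw [coeff_mul_X]
    cases k with
    | zero => simp
    | succ k => rw [coeff_mul_X, coeff_derivative]; push_cast; ring
  simp only [coeff_sub, hX, coeff_C_mul, coeff_mul_X, coeff_derivative] at hc
  push_cast at hc ⊢
  linear_combination hc

theorem abs_omegaW_le_choose {n m : ℕ} (hm : m ≤ n) (k : ℕ) :
    |omegaW n m k| ≤ (n.choose k : ℤ) := by
  have h : n.choose k = ∑ s ∈ range (k + 1), m.choose s * (n - m).choose (k - s) := by
    conv_lhs => rw [← Nat.add_sub_cancel' hm, Nat.add_choose_eq,
      Finset.Nat.sum_antidiagonal_eq_sum_range_succ_mk]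
  rw [h]
  push_cast
  refine (Finset.abs_sum_le_sum_abs _ _).trans (Finset.sum_le_sum fun s _ => ?_)
  simp [abs_mul]

theorem abs_omegaW_le_pow {n m : ℕ} (hm : m ≤ n) (k : ℕ) :
    |(omegaW n m k : ℝ)| ≤ (n : ℝ) ^ k := by
  have h := abs_omegaW_le_choose hm k
  have h' : |(omegaW n m k : ℝ)| ≤ (n.choose k : ℝ) := by exact_mod_cast h
  refine h'.trans ?_
  exact_mod_cast Nat.choose_le_pow n k

theorem abs_sub_two_mul_le {n m : ℕ} (hm : m ≤ n) : |(n : ℝ) - 2 * m| ≤ n := by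
  have : (m : ℝ) ≤ n := by exact_mod_cast hm
  have : (0 : ℝ) ≤ m := by positivity
  rw [abs_le]; constructor <;> linarith

/-- The leading term of a Krawtchouk polynomial, with a uniform error. -/
theorem exists_abs_factorial_mul_omegaW_sub_pow_le (k : ℕ) :
    ∃ C : ℝ, 0 ≤ C ∧ ∀ n m : ℕ, m ≤ n →
      |((k + 1).factorial : ℝ) * omegaW n m (k + 1) - ((n : ℝ) - 2 * m) ^ (k + 1)|
        ≤ C * (n : ℝ) ^ k := by
  induction k with
  | zero => exact ⟨0, le_rfl, fun n m hm => by simp [omegaW_one hm]⟩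
  | succ k ih =>
    obtain ⟨C, hC, h⟩ := ih
    refine ⟨C + (k + 1).factorial * (k + 1), by positivity, fun n m hm => ?_⟩
    have hrec : ((k : ℝ) + 2) * omegaW n m (k + 2) =
        (n - 2 * m) * omegaW n m (k + 1) - (n - k) * omegaW n m k := by
      exact_mod_cast omegaW_recurrence hm k
    have hid : ((k + 1 + 1).factorial : ℝ) * omegaW n m (k + 1 + 1)
          - ((n : ℝ) - 2 * m) ^ (k + 1 + 1)
        = ((n : ℝ) - 2 * m) * (((k + 1).factorial : ℝ) * omegaW n m (k + 1)
          - ((n : ℝ) - 2 * m) ^ (k + 1))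
          - ((k + 1).factorial : ℝ) * (((n : ℝ) - k) * omegaW n m k) := by
      rw [Nat.factorial_succ (k + 1)]
      push_cast
      linear_combination ((k + 1).factorial : ℝ) * hrec
    have hnk : |((n : ℝ) - k) * omegaW n m k| ≤ (k + 1) * (n : ℝ) ^ (k + 1) := by
      rcases Nat.eq_zero_or_pos n with rfl | hn
      · obtain rfl : m = 0 := by omega
        rcases k with _ | k
        · simp
        · have : omegaW 0 0 (k + 1) = 0 := by
            have := abs_omegaW_le_choose le_rfl (n := 0) (k + 1)
            simpa using this
          simp [this]
      · have hn' : (1 : ℝ) ≤ n := by exact_mod_cast hn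
        have h1 : |(n : ℝ) - k| ≤ (k + 1) * n := by
          have : (0 : ℝ) ≤ k := by positivity
          rw [abs_le]; constructor <;> nlinarith
        rw [abs_mul, pow_succ', ← mul_assoc]
        exact mul_le_mul h1 (abs_omegaW_le_pow hm k) (abs_nonneg _) (by positivity)
    rw [hid]
    refine (abs_sub _ _).trans ?_
    rw [abs_mul, abs_mul, Nat.abs_cast]
    have := mul_le_mul (abs_sub_two_mul_le hm) (h n m hm) (abs_nonneg _) (by positivity)
    have h2 := mul_le_mul_of_nonneg_left hnk (Nat.cast_nonneg (α := ℝ) (k + 1).factorial)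
    calc _ ≤ _ := add_le_add this h2
      _ = _ := by ring

theorem pow_succ_sub_descFactorial_le (n k : ℕ) :
    (n : ℝ) ^ (k + 1) - n.descFactorial (k + 1) ≤ (k + 1) ^ 2 * (n : ℝ) ^ k := by
  induction k with
  | zero => simp
  | succ k ih =>
    rw [Nat.descFactorial_succ]
    have h1 : (n : ℝ) - (k + 1) ≤ ((n - (k + 1) : ℕ) : ℝ) := by
      rw [sub_le_iff_le_add]
      exact_mod_cast (by omega : n ≤ n - (k + 1) + (k + 1))
    have h2 : (n.descFactorial (k + 1) : ℝ) ≤ (n : ℝ) ^ (k + 1) := by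
      exact_mod_cast Nat.descFactorial_le_pow n (k + 1)
    have h3 : (0 : ℝ) ≤ n.descFactorial (k + 1) := by positivity
    have h4 := mul_le_mul_of_nonneg_left ih (Nat.cast_nonneg (α := ℝ) n)
    push_cast
    have h5 := mul_le_mul_of_nonneg_right h1 h3
    have h6 := mul_le_mul_of_nonneg_left h2 (by positivity : (0 : ℝ) ≤ k + 1)
    have h7 : (0 : ℝ) ≤ (n : ℝ) ^ (k + 1) := by positivity
    have h8 : (0 : ℝ) ≤ (k : ℝ) * (n : ℝ) ^ (k + 1) := by positivity
    rw [pow_succ (n : ℝ) (k + 1)]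
    have h9 : (n : ℝ) * ((k + 1) ^ 2 * (n : ℝ) ^ k) = (k + 1) ^ 2 * (n : ℝ) ^ (k + 1) := by ring
    rw [h9] at h4
    nlinarith

/-- The normalised Krawtchouk polynomial is `|1 - 2 m / n| ^ k` up to `O(1 / n)`. -/
theorem exists_abs_omegaW_div_choose_le (k : ℕ) :
    ∃ C : ℝ, 0 ≤ C ∧ ∀ n m : ℕ, 2 * (k + 1) ≤ n → m ≤ n →
      |(omegaW n m (k + 1) : ℝ) / n.choose (k + 1)|
        ≤ |((n : ℝ) - 2 * m) / n| ^ (k + 1) + C / n := by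
  obtain ⟨C, hC, h⟩ := exists_abs_factorial_mul_omegaW_sub_pow_le k
  refine ⟨(C + (k + 1) ^ 2) * 2 ^ (k + 1), by positivity, fun n m hn hm => ?_⟩
  have hn0 : (0 : ℝ) < n := by exact_mod_cast (by omega : 0 < n)
  set D : ℝ := ((n.descFactorial (k + 1) : ℕ) : ℝ) with hD
  have hDc : D = (k + 1).factorial * n.choose (k + 1) := by
    rw [hD, Nat.descFactorial_eq_factorial_mul_choose]; push_cast; ring
  have hF : (0 : ℝ) < (k + 1).factorial := by positivity
  have hlow : ((n : ℝ) / 2) ^ (k + 1) ≤ D := by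
    have h1 : (n + 1 - (k + 1)) ^ (k + 1) ≤ n.descFactorial (k + 1) :=
      Nat.pow_sub_le_descFactorial n (k + 1)
    have h2 : (n : ℝ) / 2 ≤ ((n + 1 - (k + 1) : ℕ) : ℝ) := by
      rw [div_le_iff₀ (by norm_num)]
      exact_mod_cast (by omega : n ≤ (n + 1 - (k + 1)) * 2)
    calc _ ≤ ((n + 1 - (k + 1) : ℕ) : ℝ) ^ (k + 1) := by gcongr
      _ ≤ D := by rw [hD]; exact_mod_cast h1
  have hDpos : 0 < D := lt_of_lt_of_le (by positivity) hlow
  set u : ℝ := |((n : ℝ) - 2 * m) / n| with hu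
  have hu0 : 0 ≤ u := abs_nonneg _
  have hu1 : u ≤ 1 := by
    rw [hu, abs_div, Nat.abs_cast]
    exact div_le_one_of_le₀ (abs_sub_two_mul_le hm) hn0.le
  have hpow : |((n : ℝ) - 2 * m) ^ (k + 1)| = u ^ (k + 1) * (n : ℝ) ^ (k + 1) := by
    rw [hu, abs_div, Nat.abs_cast, div_pow, abs_pow]
    field_simp
  have hX : ((k + 1).factorial : ℝ) * |(omegaW n m (k + 1) : ℝ)|
      ≤ u ^ (k + 1) * (n : ℝ) ^ (k + 1) + C * (n : ℝ) ^ k := by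
    have := (abs_sub_abs_le_abs_sub _ _).trans (h n m hm)
    rw [hpow, abs_mul, Nat.abs_cast] at this
    linarith
  have hY : u ^ (k + 1) * (n : ℝ) ^ (k + 1) ≤ u ^ (k + 1) * D + (k + 1) ^ 2 * (n : ℝ) ^ k := by
    have h1 := pow_succ_sub_descFactorial_le n k
    have h2 : u ^ (k + 1) ≤ 1 := pow_le_one₀ hu0 hu1
    have h3 := mul_le_mul_of_nonneg_left h1 (by positivity : 0 ≤ u ^ (k + 1))
    have h4 := mul_le_mul_of_nonneg_right h2
      (by positivity : (0 : ℝ) ≤ (k + 1) ^ 2 * (n : ℝ) ^ k)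
    linarith
  have hZ : (n : ℝ) ^ k ≤ 2 ^ (k + 1) / n * D := by
    have := mul_le_mul_of_nonneg_left hlow (by positivity : (0 : ℝ) ≤ 2 ^ (k + 1) / n)
    refine le_trans (le_of_eq ?_) this
    rw [div_pow, pow_succ (n : ℝ)]
    field_simp
  have hq : |(omegaW n m (k + 1) : ℝ) / n.choose (k + 1)|
      = (k + 1).factorial * |(omegaW n m (k + 1) : ℝ)| / D := by
    rw [abs_div, Nat.abs_cast, hDc, mul_div_mul_left _ _ hF.ne']
  rw [hq, div_le_iff₀ hDpos]
  have := mul_le_mul_of_nonneg_left hZ (by positivity : (0 : ℝ) ≤ C + (k + 1) ^ 2)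
  calc _ ≤ u ^ (k + 1) * D + (C + (k + 1) ^ 2) * (n : ℝ) ^ k := by linarith
    _ ≤ u ^ (k + 1) * D + (C + (k + 1) ^ 2) * (2 ^ (k + 1) / n * D) := by linarith
    _ = _ := by ring

theorem Hent_one_sub (x : ℝ) : Hent (1 - x) = Hent x := by
  simp only [Hent, sub_sub_cancel]
  ring

theorem continuous_Hent : Continuous Hent :=
  Real.continuous_mul_log.add
    (Real.continuous_mul_log.comp (continuous_const.sub continuous_id))

/-- A quadratic lower bound for the entropy near `1 / 2`. -/
theorem sq_div_six_le_log_two_add_Hent {u : ℝ} (hu0 : 0 ≤ u) (hu1 : u < 1) :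
    u ^ 2 / 6 ≤ Real.log 2 + Hent ((1 - u) / 2) := by
  have h1 : 0 < 1 - u := by linarith
  have h2 : 0 < 1 + u := by linarith
  have hlog : Real.log 2 + Hent ((1 - u) / 2)
      = ((1 + u) * Real.log (1 + u) + (1 - u) * Real.log (1 - u)) / 2 := by
    have : 1 - (1 - u) / 2 = (1 + u) / 2 := by ring
    rw [Hent, this, Real.log_div h1.ne' (by norm_num), Real.log_div h2.ne' (by norm_num)]
    ring
  have hp : u + u ^ 2 / 3 ≤ (1 + u) * Real.log (1 + u) := by
    have h3 := mul_le_mul_of_nonneg_left (Real.le_log_one_add_of_nonneg hu0) h2.le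
    refine le_trans ?_ h3
    rw [← mul_div_assoc, le_div_iff₀ (by linarith)]
    nlinarith [sq_nonneg u, mul_nonneg (sq_nonneg u) h1.le]
  have hm : -u ≤ (1 - u) * Real.log (1 - u) := by
    have h3 := mul_le_mul_of_nonneg_left (Real.one_sub_inv_le_log_of_pos h1) h1.le
    rw [mul_sub, mul_inv_cancel₀ h1.ne'] at h3
    linarith
  rw [hlog]
  linarith

/-- If the rate function is positive, it grows at least quadratically. -/
theorem exists_pos_mul_sq_le_rate {k : ℕ} (hk : 3 ≤ k) {c : ℝ} (hc0 : 0 < c) (hc1 : c < 1)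
    (hθ : ∀ x : ℝ, 0 < x → x < 1 / 2 →
      c * Real.log (1 + (1 - 2 * x) ^ k) < Real.log 2 + Hent x) :
    ∃ δ : ℝ, 0 < δ ∧ ∀ u : ℝ, 0 ≤ u → u ≤ 1 →
      δ * u ^ 2 ≤ Real.log 2 + Hent ((1 - u) / 2) - c * Real.log (1 + u ^ k) := by
  set G : ℝ → ℝ := fun u => Real.log 2 + Hent ((1 - u) / 2) - c * Real.log (1 + u ^ k) with hG
  have hpos : ∀ u ∈ Set.Icc (1 / 12 : ℝ) 1, 0 < G u := by
    rintro u ⟨h0, h1⟩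
    rcases h1.lt_or_eq with h1 | rfl
    · have h := hθ ((1 - u) / 2) (by linarith) (by linarith)
      rw [show 1 - 2 * ((1 - u) / 2) = u by ring] at h
      exact sub_pos.2 h
    · have : 0 < Real.log 2 := Real.log_pos (by norm_num)
      simp only [hG, Hent, sub_self, zero_div, one_pow]
      norm_num
      nlinarith
  have hcont : ContinuousOn G (Set.Icc (1 / 12 : ℝ) 1) := by
    refine ContinuousOn.sub (Continuous.continuousOn ?_) (ContinuousOn.mul continuousOn_const ?_)
    · exact continuous_const.add (continuous_Hent.comp (by fun_prop))
    · refine ContinuousOn.log (by fun_prop) fun u hu => ?_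
      have : 0 ≤ u := by linarith [hu.1]
      positivity
  obtain ⟨v, hv, hmin⟩ := isCompact_Icc.exists_isMinOn ⟨1, by norm_num⟩ hcont
  refine ⟨min (1 / 12) (G v), lt_min (by norm_num) (hpos v hv), fun u h0 h1 => ?_⟩
  rcases le_total u (1 / 12) with h | h
  · have hq := sq_div_six_le_log_two_add_Hent h0 (by linarith)
    have hl : c * Real.log (1 + u ^ k) ≤ u ^ 2 / 12 := by
      have hk0 : 0 ≤ u ^ k := by positivity
      have h3 : Real.log (1 + u ^ k) ≤ u ^ k := by
        have := Real.log_le_sub_one_of_pos (by positivity : 0 < 1 + u ^ k)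
        linarith
      have h4 : 0 ≤ Real.log (1 + u ^ k) := Real.log_nonneg (by linarith)
      have h5 : u ^ k ≤ u ^ 3 := pow_le_pow_of_le_one h0 h1 hk
      have h6 : u ^ 3 ≤ u ^ 2 / 12 := by nlinarith [sq_nonneg u]
      nlinarith
    have h7 := mul_le_mul_of_nonneg_right (min_le_left (1 / 12) (G v)) (sq_nonneg u)
    linarith
  · have h2 : G v ≤ G u := hmin ⟨h, h1⟩
    have h3 : u ^ 2 ≤ 1 := pow_le_one₀ h0 h1
    have h4 := min_le_right (1 / 12) (G v)
    have h5 := hpos v hv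
    have h6 := mul_le_mul_of_nonneg_right h4 (sq_nonneg u)
    nlinarith

theorem Real.pow_eq_exp_mul_log {x : ℝ} {m : ℕ} (hx : 0 ≤ x) (h : x = 0 → m = 0) :
    x ^ m = Real.exp (m * Real.log x) := by
  rcases hx.eq_or_lt with rfl | hx
  · simp [h rfl]
  · rw [Real.exp_nat_mul, Real.exp_log hx]

/-- The entropy bound for a single binomial coefficient. -/
theorem choose_le_exp_neg_mul_Hent {n m : ℕ} (hn : 0 < n) (hm : m ≤ n) :
    (n.choose m : ℝ) ≤ Real.exp (-(n * Hent (m / n))) := by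
  have hn0 : (0 : ℝ) < n := by exact_mod_cast hn
  set x : ℝ := m / n with hx
  have hx0 : 0 ≤ x := by positivity
  have hx1 : 0 ≤ 1 - x := by
    rw [sub_nonneg, hx, div_le_one hn0]
    exact_mod_cast hm
  have hmx : (m : ℝ) = n * x := by rw [hx]; field_simp
  have hmx' : ((n - m : ℕ) : ℝ) = n * (1 - x) := by rw [Nat.cast_sub hm, hmx]; ring
  have hle : x ^ m * (1 - x) ^ (n - m) * n.choose m ≤ 1 := by
    have h := add_pow x (1 - x) n
    rw [add_sub_cancel, one_pow] at h
    refine le_of_le_of_eq ?_ h.symm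
    exact Finset.single_le_sum
      (f := fun m => x ^ m * (1 - x) ^ (n - m) * (n.choose m : ℝ))
      (fun i _ => by positivity) (mem_range.2 (Nat.lt_succ_of_le hm))
  have h1 : x ^ m = Real.exp (m * Real.log x) := by
    refine Real.pow_eq_exp_mul_log hx0 fun h => ?_
    rw [h, mul_zero] at hmx
    exact_mod_cast hmx
  have h2 : (1 - x) ^ (n - m) = Real.exp ((n - m : ℕ) * Real.log (1 - x)) := by
    refine Real.pow_eq_exp_mul_log hx1 fun h => ?_
    rw [h, mul_zero] at hmx'
    exact_mod_cast hmx'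
  have he : (m : ℝ) * Real.log x + (n - m : ℕ) * Real.log (1 - x) = n * Hent x := by
    rw [hmx, hmx', Hent]
    ring
  rw [h1, h2, ← Real.exp_add, he] at hle
  rwa [Real.exp_neg, ← one_div, le_div_iff₀ (Real.exp_pos _), mul_comm (n.choose m : ℝ)]

/-- A power of a perturbed base, bounded by the unperturbed exponential rate. -/
theorem abs_one_add_pow_floor_le {c C w z : ℝ} {n : ℕ} (hc : 0 ≤ c) (hn : 0 < n)
    (hC : 0 ≤ C) (hz : 0 ≤ z) (hw : |w| ≤ z + C / n) :
    |1 + w| ^ ⌊c * n⌋₊ ≤ Real.exp (c * n * Real.log (1 + z) + c * C) := by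
  have hn0 : (0 : ℝ) < n := by exact_mod_cast hn
  have he : 0 ≤ C / n := by positivity
  have hb : |1 + w| ≤ Real.exp (Real.log (1 + z) + C / n) := by
    rw [Real.exp_add, Real.exp_log (by linarith)]
    have h1 := abs_add_le 1 w
    rw [abs_one] at h1
    have h2 := mul_le_mul_of_nonneg_left (Real.add_one_le_exp (C / n))
      (by linarith : 0 ≤ 1 + z)
    nlinarith
  have hl : 0 ≤ Real.log (1 + z) + C / n := add_nonneg (Real.log_nonneg (by linarith)) he
  calc |1 + w| ^ ⌊c * n⌋₊ ≤ Real.exp (Real.log (1 + z) + C / n) ^ ⌊c * n⌋₊ := by gcongr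
    _ = Real.exp (⌊c * n⌋₊ * (Real.log (1 + z) + C / n)) := (Real.exp_nat_mul _ _).symm
    _ ≤ Real.exp (c * n * (Real.log (1 + z) + C / n)) := by
      gcongr
      exact Nat.floor_le (by positivity)
    _ = _ := by
      congr 1
      field_simp

/-- Outside the window around `n / 2`, the quadratic rate is at least `n ^ (1 / 9)`. -/
theorem rpow_one_ninth_le_mul_sq {k : ℕ} (hk : 3 ≤ k) {n m : ℕ} (hn : 0 < n)
    (h : (n : ℝ) ^ ((1 : ℝ) - 4 / (3 * k)) ≤ |(m : ℝ) - n / 2|) :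
    (n : ℝ) ^ (1 / 9 : ℝ) ≤ n * |((n : ℝ) - 2 * m) / n| ^ 2 := by
  have hn0 : (0 : ℝ) < n := by exact_mod_cast hn
  have hn1 : (1 : ℝ) ≤ n := by exact_mod_cast hn
  have hk' : (3 : ℝ) ≤ k := by exact_mod_cast hk
  have h59 : (n : ℝ) ^ (5 / 9 : ℝ) ≤ |(m : ℝ) - n / 2| := by
    refine le_trans (Real.rpow_le_rpow_of_exponent_le hn1 ?_) h
    have : 4 / (3 * (k : ℝ)) ≤ 4 / 9 := by
      rw [div_le_div_iff₀ (by positivity) (by norm_num)]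
      linarith
    linarith
  have hsq : (n : ℝ) ^ (1 / 9 : ℝ) * n = ((n : ℝ) ^ (5 / 9 : ℝ)) ^ 2 := by
    rw [← Real.rpow_natCast, ← Real.rpow_mul hn0.le, ← Real.rpow_add_one hn0.ne']
    norm_num
  have h2 : ((n : ℝ) ^ (5 / 9 : ℝ)) ^ 2 ≤ ((m : ℝ) - n / 2) ^ 2 := by
    rw [← sq_abs ((m : ℝ) - n / 2)]
    gcongr
  have h3 : (n : ℝ) * |((n : ℝ) - 2 * m) / n| ^ 2 = 4 * ((m : ℝ) - n / 2) ^ 2 / n := by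
    rw [sq_abs]
    field_simp
    ring
  rw [h3, le_div_iff₀ hn0, hsq]
  nlinarith [sq_nonneg ((m : ℝ) - n / 2)]

theorem tendsto_add_one_mul_exp_neg_rpow {δ : ℝ} (hδ : 0 < δ) (A : ℝ) :
    Tendsto (fun n : ℕ => ((n : ℝ) + 1) * Real.exp (A - δ * (n : ℝ) ^ (1 / 9 : ℝ)))
      atTop (nhds 0) := by
  have ht : Tendsto (fun n : ℕ => (n : ℝ) ^ (1 / 9 : ℝ)) atTop atTop :=
    (tendsto_rpow_atTop (by norm_num)).comp tendsto_natCast_atTop_atTop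
  have h9 := (tendsto_rpow_mul_exp_neg_mul_atTop_nhds_zero 9 δ hδ).comp ht
  have h0 := (tendsto_rpow_mul_exp_neg_mul_atTop_nhds_zero 0 δ hδ).comp ht
  have h := (h9.add h0).const_mul (Real.exp A)
  simp only [add_zero, mul_zero] at h
  refine h.congr fun n => ?_
  have : ((n : ℝ) ^ (1 / 9 : ℝ)) ^ (9 : ℝ) = n := by
    rw [← Real.rpow_mul (Nat.cast_nonneg n)]
    norm_num
  simp only [Function.comp_apply, this, Real.rpow_zero, sub_eq_add_neg, Real.exp_add, neg_mul]
  ring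

/-- Claim 2: if `0 < c < 1` and `c < θ_k` then `Σ₂(⌊c·n⌋,k) → 0` as `n → ∞`. -/
theorem Sigma2_tendsto_zero (k : ℕ) (hk : 3 ≤ k) (c : ℝ) (hc0 : 0 < c) (hc1 : c < 1)
    (hθ : ∀ x : ℝ, 0 < x → x < 1 / 2 →
      c * Real.log (1 + (1 - 2 * x) ^ k) < Real.log 2 + Hent x) :
    Tendsto (fun n : ℕ => (2 : ℝ) ^ (-(n : ℤ)) *
        ∑ m ∈ (Finset.range (n + 1)).filter
          (fun m : ℕ => (n : ℝ) ^ ((1 : ℝ) - 4 / (3 * k)) ≤ |(m : ℝ) - n / 2|),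
          (n.choose m : ℝ) * (1 + (omegaW n m k : ℝ) / (n.choose k : ℝ)) ^ ⌊c * n⌋₊)
      atTop (nhds 0) := by
  obtain ⟨δ, hδ, hrate⟩ := exists_pos_mul_sq_le_rate hk hc0 hc1 hθ
  obtain ⟨C, hC, hω⟩ : ∃ C : ℝ, 0 ≤ C ∧ ∀ n m : ℕ, 2 * k ≤ n → m ≤ n →
      |(omegaW n m k : ℝ) / n.choose k| ≤ |((n : ℝ) - 2 * m) / n| ^ k + C / n := by
    obtain ⟨k, rfl⟩ := Nat.exists_eq_add_of_lt (by omega : 0 < k)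
    simpa using exists_abs_omegaW_div_choose_le k
  refine squeeze_zero_norm' ?_ (tendsto_add_one_mul_exp_neg_rpow hδ (c * C))
  filter_upwards [eventually_ge_atTop (2 * k)] with n hn
  have hnpos : 0 < n := by omega
  have hn0 : (0 : ℝ) < n := by exact_mod_cast hnpos
  rw [mul_sum]
  refine (norm_sum_le _ _).trans ((sum_le_card_nsmul _ _
    (Real.exp (c * C - δ * (n : ℝ) ^ (1 / 9 : ℝ))) fun m hm => ?_).trans ?_)
  · obtain ⟨hmn, hdev⟩ := mem_filter.1 hm
    have hmn : m ≤ n := Nat.lt_succ_iff.1 (mem_range.1 hmn)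
    set u : ℝ := |((n : ℝ) - 2 * m) / n| with hu
    have hu1 : u ≤ 1 := by
      rw [hu, abs_div, Nat.abs_cast]
      exact div_le_one_of_le₀ (abs_sub_two_mul_le hmn) hn0.le
    have hH : Hent ((1 - u) / 2) = Hent (m / n) := by
      have h1 : ((n : ℝ) - 2 * m) / n = 1 - 2 * (m / n) := by field_simp
      rcases abs_choice (((n : ℝ) - 2 * m) / n) with h | h
      · rw [hu, h, h1]
        congr 1
        ring
      · rw [hu, h, h1, ← Hent_one_sub]
        congr 1
        ring
    have hr := mul_le_mul_of_nonneg_left (hrate u (abs_nonneg _) hu1) hn0.le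
    have hd := mul_le_mul_of_nonneg_left (rpow_one_ninth_le_mul_sq hk hnpos hdev) hδ.le
    rw [hH] at hr
    have h2 : (2 : ℝ) ^ (-(n : ℤ)) = Real.exp (-(n * Real.log 2)) := by
      rw [zpow_neg, zpow_natCast, Real.exp_neg, Real.exp_nat_mul, Real.exp_log (by norm_num)]
    rw [Real.norm_eq_abs, abs_mul, abs_mul, abs_pow, Nat.abs_cast, h2, Real.abs_exp]
    calc _ ≤ Real.exp (-(n * Real.log 2)) * (Real.exp (-(n * Hent (m / n)))
          * Real.exp (c * n * Real.log (1 + u ^ k) + c * C)) := by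
          gcongr
          · exact choose_le_exp_neg_mul_Hent hnpos hmn
          · exact abs_one_add_pow_floor_le hc0.le hnpos hC (by positivity) (hω n m hn hmn)
      _ ≤ _ := by
          rw [← Real.exp_add, ← Real.exp_add, Real.exp_le_exp]
          linarith
  · rw [nsmul_eq_mul]
    gcongr
    exact_mod_cast (card_filter_le _ _).trans (card_range (n + 1)).le
end
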